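/- In ℚ[SL₂(F)], the four elements M₁₁, M₁₂, M₂₁, M₂₂ behave like 2×2 matrix units: Mᵢⱼ·Mₖₗ = Mᵢₗ if j = k and Mᵢⱼ·Mₖₗ = 0 if j ≠ k (for all i, j, k, l ∈ {1,2}), and M₁₁ + M₂₂ = π₄. -/

import Mathlib

open MonoidAlgebra

/-- Sum of all elements of `SL₂(F)` whose support pattern is given by the four
Booleans (`true` = the entry is nonzero, `false` = the entry is zero). -/
noncomputable def suppClass (R : Type*) [CommRing R] (F : Type*) [Field F] [Fintype F]
    [DecidableEq F] (b₁₁ b₁₂ b₂₁ b₂₂ : Bool) :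
    MonoidAlgebra R (Matrix.SpecialLinearGroup (Fin 2) F) :=
  ∑ g ∈ Finset.univ.filter
      (fun g : Matrix.SpecialLinearGroup (Fin 2) F =>
        (b₁₁ = true ↔ (g : Matrix (Fin 2) (Fin 2) F) 0 0 ≠ 0) ∧
        (b₁₂ = true ↔ (g : Matrix (Fin 2) (Fin 2) F) 0 1 ≠ 0) ∧
        (b₂₁ = true ↔ (g : Matrix (Fin 2) (Fin 2) F) 1 0 ≠ 0) ∧
        (b₂₂ = true ↔ (g : Matrix (Fin 2) (Fin 2) F) 1 1 ≠ 0)),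
    MonoidAlgebra.of R (Matrix.SpecialLinearGroup (Fin 2) F) g

/-- The support class `A` (diagonal matrices). -/
noncomputable def elA (R : Type*) [CommRing R] (F : Type*) [Field F] [Fintype F] [DecidableEq F] :=
  suppClass R F true false false true
/-- The support class `B` (antidiagonal matrices). -/
noncomputable def elB (R : Type*) [CommRing R] (F : Type*) [Field F] [Fintype F] [DecidableEq F] :=
  suppClass R F false true true false
/-- The support class `C` (matrices with all entries nonzero). -/
noncomputable def elC (R : Type*) [CommRing R] (F : Type*) [Field F] [Fintype F] [DecidableEq F] :=
  suppClass R F true true true true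
/-- The support class `D₊` (upper triangular with nonzero entries). -/
noncomputable def elDp (R : Type*) [CommRing R] (F : Type*) [Field F] [Fintype F] [DecidableEq F] :=
  suppClass R F true true false true
/-- The support class `D₋` (lower triangular with nonzero entries). -/
noncomputable def elDm (R : Type*) [CommRing R] (F : Type*) [Field F] [Fintype F] [DecidableEq F] :=
  suppClass R F true false true true
/-- The support class `E₊`. -/
noncomputable def elEp (R : Type*) [CommRing R] (F : Type*) [Field F] [Fintype F] [DecidableEq F] :=
  suppClass R F true true true false
/-- The support class `E₋`. -/
noncomputable def elEm (R : Type*) [CommRing R] (F : Type*) [Field F] [Fintype F] [DecidableEq F] :=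
  suppClass R F false true true true

set_option linter.all false

namespace SuppAux

/-- The purely algebraic part: the relations between the normalised Borel, torus, Weyl and
total sums imply the matrix unit relations. -/
theorem alg {H : Type*} [Ring H] [Algebra ℚ H] (q : ℚ) (h1 : q + 1 ≠ 0) (h2 : q - 1 ≠ 0)
    (e s x t : H)
    (ee : e * e = e) (es : e * s = s) (se : s * e = s) (ss : s * s = e)
    (ex : e * x = x) (xe : x * e = x) (xx : x * x = q • x) (xsx : x * (s * x) = t - x)
    (et : e * t = t) (te : t * e = t) (st : s * t = t) (ts : t * s = t)
    (xt : x * t = q • t) (tx : t * x = q • t)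
    (A B C Dp Dm Ep Em : H)
    (hA : A = (q - 1) • e) (hB : B = (q - 1) • s)
    (hDp : Dp = (q - 1) • x - A) (hDm : Dm = (q - 1) • (s * (x * s)) - A)
    (hEp : Ep = (q - 1) • (x * s) - B) (hEm : Em = (q - 1) • (s * x) - B)
    (hC : C = (q - 1) • t - A - B - Dp - Dm - Ep - Em)
    (M : Fin 2 → Fin 2 → H)
    (hM₁₁ : M 0 0 = (q ^ 2 - 1)⁻¹ • (A - B) + (2 * (q ^ 2 - 1))⁻¹ • (Dp + Dm - Ep - Em))
    (hM₁₂ : M 0 1 = (2 * (q - 1) ^ 2)⁻¹ • (Dp - Dm + Ep - Em))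
    (hM₂₁ : M 1 0 = (2 * (q ^ 2 - 1))⁻¹ • (Dp - Dm - Ep + Em))
    (hM₂₂ : M 1 1 = (q ^ 2 - 1)⁻¹ • (A + B) - (2 / ((q + 1) * (q - 1) ^ 2)) • C +
      ((q - 3) / (2 * (q + 1) * (q - 1) ^ 2)) • (Dp + Dm + Ep + Em)) :
    ∀ i j k l : Fin 2, M i j * M k l = if j = k then M i l else 0 := by
  have h3 : q ^ 2 - 1 ≠ 0 := by
    have : q ^ 2 - 1 = (q + 1) * (q - 1) := by ring
    rw [this]; exact mul_ne_zero h1 h2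
  have k11 : M 0 0 = (2 * (q + 1))⁻¹ • (x + s * (x * s) - x * s - s * x) := by
    rw [hM₁₁, hDp, hDm, hEp, hEm, hA, hB]
    match_scalars <;> field_simp <;> ring
  have k12 : M 0 1 = (2 * (q - 1))⁻¹ • (x - s * (x * s) + x * s - s * x) := by
    rw [hM₁₂, hDp, hDm, hEp, hEm, hA, hB]
    match_scalars <;> field_simp <;> ring
  have k21 : M 1 0 = (2 * (q + 1))⁻¹ • (x - s * (x * s) - x * s + s * x) := by
    rw [hM₂₁, hDp, hDm, hEp, hEm, hA, hB]
    match_scalars <;> field_simp <;> ring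
  have k22 : M 1 1 = (2 * (q - 1))⁻¹ • (x + s * (x * s) + x * s + s * x)
      - (2 / ((q + 1) * (q - 1))) • t := by
    rw [hM₂₂, hC, hDp, hDm, hEp, hEm, hA, hB]
    match_scalars <;> field_simp <;> ring
  have tt : t * t = (q * (q + 1)) • t := by
    have : t = x * (s * x) + x := by rw [xsx]; abel
    calc t * t = t * (x * (s * x) + x) := by rw [← this]
      _ = ((t * x) * s) * x + t * x := by noncomm_ring
      _ = _ := by
        simp only [tx, smul_mul_assoc, ts]
        module
  have es' (z : H) : e * (s * z) = s * z := by rw [← mul_assoc, es]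
  have ss' (z : H) : s * (s * z) = e * z := by rw [← mul_assoc, ss]
  have ex' (z : H) : e * (x * z) = x * z := by rw [← mul_assoc, ex]
  have xe' (z : H) : x * (e * z) = x * z := by rw [← mul_assoc, xe]
  have se' (z : H) : s * (e * z) = s * z := by rw [← mul_assoc, se]
  have xx' (z : H) : x * (x * z) = q • (x * z) := by rw [← mul_assoc, xx, smul_mul_assoc]
  have xsx' (z : H) : x * (s * (x * z)) = t * z - x * z := by
    rw [← mul_assoc s, ← mul_assoc x, xsx, sub_mul]
  have ts' (z : H) : t * (s * z) = t * z := by rw [← mul_assoc, ts]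
  have tx' (z : H) : t * (x * z) = q • (t * z) := by rw [← mul_assoc, tx, smul_mul_assoc]
  intro i j k l
  fin_cases i <;> fin_cases j <;> fin_cases k <;> fin_cases l <;>
    simp only [Fin.zero_eta, Fin.mk_one, Fin.isValue, k11, k12, k21, k22, if_true,
      zero_ne_one, one_ne_zero, if_false] <;>
    simp only [mul_add, add_mul, mul_sub, sub_mul, smul_mul_assoc, mul_smul_comm, mul_assoc,
      ee, es, se, ss, ex, xe, xx, xsx, et, te, st, ts, xt, tx, tt, smul_sub, smul_add,
      es', ss', ex', xe', se', xx', xsx', ts', tx'] <;>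
    match_scalars <;> field_simp <;> ring

variable {F : Type*} [Field F] [Fintype F] [DecidableEq F]

/-- Sum of the group elements satisfying `P`. -/
noncomputable def cl (P : Matrix.SpecialLinearGroup (Fin 2) F → Prop) [DecidablePred P] :
    MonoidAlgebra ℚ (Matrix.SpecialLinearGroup (Fin 2) F) :=
  ∑ g, if P g then MonoidAlgebra.of ℚ _ g else 0

theorem cl_congr (P Q : Matrix.SpecialLinearGroup (Fin 2) F → Prop) [DecidablePred P]
    [DecidablePred Q] (h : ∀ g, P g ↔ Q g) : cl P = cl Q := by
  unfold cl; exact Finset.sum_congr rfl fun g _ => by simp only [h]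

theorem cl_add (P Q R : Matrix.SpecialLinearGroup (Fin 2) F → Prop) [DecidablePred P]
    [DecidablePred Q] [DecidablePred R] (h : ∀ g, R g ↔ P g ∨ Q g) (h' : ∀ g, ¬ (P g ∧ Q g)) :
    cl R = cl P + cl Q := by
  unfold cl
  rw [← Finset.sum_add_distrib]
  refine Finset.sum_congr rfl fun g _ => ?_
  have a := h g
  have b := h' g
  by_cases p : P g <;> by_cases r : Q g <;> simp_all

theorem of_mul_cl (P R : Matrix.SpecialLinearGroup (Fin 2) F → Prop) [DecidablePred P]
    [DecidablePred R] (h : Matrix.SpecialLinearGroup (Fin 2) F) (H : ∀ g, R (h * g) ↔ P g) :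
    MonoidAlgebra.of ℚ _ h * cl P = cl R := by
  unfold cl
  rw [Finset.mul_sum]
  refine Fintype.sum_equiv (Equiv.mulLeft h) _ _ fun g => ?_
  simp only [Equiv.coe_mulLeft, H, mul_ite, mul_zero, map_mul]

theorem cl_mul_of (P R : Matrix.SpecialLinearGroup (Fin 2) F → Prop) [DecidablePred P]
    [DecidablePred R] (h : Matrix.SpecialLinearGroup (Fin 2) F) (H : ∀ g, R (g * h) ↔ P g) :
    cl P * MonoidAlgebra.of ℚ _ h = cl R := by
  unfold cl
  rw [Finset.sum_mul]
  refine Fintype.sum_equiv (Equiv.mulRight h) _ _ fun g => ?_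
  simp only [Equiv.coe_mulRight, H, ite_mul, zero_mul, map_mul]

theorem cl_mul_left (P Q R : Matrix.SpecialLinearGroup (Fin 2) F → Prop) [DecidablePred P]
    [DecidablePred Q] [DecidablePred R] (n : ℚ)
    (hn : ((Finset.univ.filter P).card : ℚ) = n) (H : ∀ h, P h → ∀ g, R (h * g) ↔ Q g) :
    cl P * cl Q = n • cl R := by
  have : ∀ h ∈ Finset.univ.filter P, MonoidAlgebra.of ℚ _ h * cl Q = cl R := fun h hh =>
    of_mul_cl Q R h (H h (by simpa using hh))
  rw [cl, ← Finset.sum_filter, Finset.sum_mul, Finset.sum_congr rfl this, Finset.sum_const, ← hn,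
    Nat.cast_smul_eq_nsmul]

theorem cl_mul_right (P Q R : Matrix.SpecialLinearGroup (Fin 2) F → Prop) [DecidablePred P]
    [DecidablePred Q] [DecidablePred R] (n : ℚ)
    (hn : ((Finset.univ.filter Q).card : ℚ) = n) (H : ∀ h, Q h → ∀ g, R (g * h) ↔ P g) :
    cl P * cl Q = n • cl R := by
  have : ∀ h ∈ Finset.univ.filter Q, cl P * MonoidAlgebra.of ℚ _ h = cl R := fun h hh =>
    cl_mul_of P R h (H h (by simpa using hh))
  rw [cl.eq_1 Q, ← Finset.sum_filter, Finset.mul_sum, Finset.sum_congr rfl this,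
    Finset.sum_const, ← hn, Nat.cast_smul_eq_nsmul]

/-- Parametrisation of the Borel subgroup. -/
def bor (p : Fˣ × F) : Matrix.SpecialLinearGroup (Fin 2) F :=
  ⟨!![(p.1 : F), p.2; 0, ((p.1⁻¹ : Fˣ) : F)], by simp [Matrix.det_fin_two]⟩

theorem det_eq (g : Matrix.SpecialLinearGroup (Fin 2) F) :
    g.1 0 0 * g.1 1 1 - g.1 0 1 * g.1 1 0 = 1 := by
  rw [← Matrix.det_fin_two]; exact g.2

theorem card_units : (Fintype.card Fˣ : ℚ) = Fintype.card F - 1 := by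
  rw [Fintype.card_units, Nat.cast_sub Fintype.card_pos, Nat.cast_one]

theorem card_X : ((Finset.univ.filter
    (fun g : Matrix.SpecialLinearGroup (Fin 2) F => g.1 1 0 = 0)).card : ℚ)
      = Fintype.card F * (Fintype.card F - 1) := by
  have : Finset.univ.filter (fun g : Matrix.SpecialLinearGroup (Fin 2) F => g.1 1 0 = 0)
      = Finset.univ.image bor := by
    ext g
    simp only [Finset.mem_filter, Finset.mem_univ, true_and, Finset.mem_image, Prod.exists]
    constructor
    · intro h
      have d := det_eq g
      rw [h, mul_zero, sub_zero] at d
      refine ⟨⟨g.1 0 0, g.1 1 1, d, by rw [mul_comm]; exact d⟩, g.1 0 1, ?_⟩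
      ext i j
      fin_cases i <;> fin_cases j <;> simp [bor, h]
    · rintro ⟨a, b, rfl⟩
      simp [bor]
  rw [this, Finset.card_image_of_injective, Finset.card_univ, Fintype.card_prod, Nat.cast_mul,
    card_units, mul_comm]
  rintro ⟨a, b⟩ ⟨c, d⟩ h
  have h0 := congrArg (fun g => g.1 0 0) h
  have h1 := congrArg (fun g => g.1 0 1) h
  simp [bor] at h0 h1
  simp [h1, Units.ext_iff, h0]

theorem card_A : ((Finset.univ.filter
    (fun g : Matrix.SpecialLinearGroup (Fin 2) F => g.1 0 1 = 0 ∧ g.1 1 0 = 0)).card : ℚ)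
      = Fintype.card F - 1 := by
  have : Finset.univ.filter
        (fun g : Matrix.SpecialLinearGroup (Fin 2) F => g.1 0 1 = 0 ∧ g.1 1 0 = 0)
      = Finset.univ.image (fun a : Fˣ => bor (a, 0)) := by
    ext g
    simp only [Finset.mem_filter, Finset.mem_univ, true_and, Finset.mem_image]
    constructor
    · rintro ⟨h', h⟩
      have d := det_eq g
      rw [h, mul_zero, sub_zero] at d
      refine ⟨⟨g.1 0 0, g.1 1 1, d, by rw [mul_comm]; exact d⟩, ?_⟩
      ext i j
      fin_cases i <;> fin_cases j <;> simp [bor, h, h']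
    · rintro ⟨a, rfl⟩
      simp [bor]
  rw [this, Finset.card_image_of_injective, Finset.card_univ, card_units]
  intro a c h
  have h0 := congrArg (fun g => g.1 0 0) h
  simp [bor] at h0
  simp [Units.ext_iff, h0]

/-- The Weyl element. -/
def wey : Matrix.SpecialLinearGroup (Fin 2) F :=
  ⟨!![0, 1; -1, 0], by simp [Matrix.det_fin_two]⟩

theorem m00 (g h : Matrix.SpecialLinearGroup (Fin 2) F) :
    (g * h).1 0 0 = g.1 0 0 * h.1 0 0 + g.1 0 1 * h.1 1 0 := by
  simp [Matrix.mul_apply, Fin.sum_univ_two]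
theorem m01 (g h : Matrix.SpecialLinearGroup (Fin 2) F) :
    (g * h).1 0 1 = g.1 0 0 * h.1 0 1 + g.1 0 1 * h.1 1 1 := by
  simp [Matrix.mul_apply, Fin.sum_univ_two]
theorem m10 (g h : Matrix.SpecialLinearGroup (Fin 2) F) :
    (g * h).1 1 0 = g.1 1 0 * h.1 0 0 + g.1 1 1 * h.1 1 0 := by
  simp [Matrix.mul_apply, Fin.sum_univ_two]
theorem m11 (g h : Matrix.SpecialLinearGroup (Fin 2) F) :
    (g * h).1 1 1 = g.1 1 0 * h.1 0 1 + g.1 1 1 * h.1 1 1 := by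
  simp [Matrix.mul_apply, Fin.sum_univ_two]

theorem card_B : ((Finset.univ.filter
    (fun g : Matrix.SpecialLinearGroup (Fin 2) F => g.1 0 0 = 0 ∧ g.1 1 1 = 0)).card : ℚ)
      = Fintype.card F - 1 := by
  rw [← card_A]
  congr 1
  refine Finset.card_equiv (Equiv.mulLeft wey) fun g => ?_
  simp only [Finset.mem_filter, Finset.mem_univ, true_and, Equiv.coe_mulLeft, m01, m10]
  simp [wey, and_comm]

theorem dA (g : Matrix.SpecialLinearGroup (Fin 2) F) (h : g.1 0 1 * g.1 1 0 = 0) :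
    g.1 0 0 ≠ 0 ∧ g.1 1 1 ≠ 0 := by
  have d := det_eq g
  constructor <;> intro k <;> rw [k] at d <;> simp [h] at d

theorem dB (g : Matrix.SpecialLinearGroup (Fin 2) F) (h : g.1 0 0 * g.1 1 1 = 0) :
    g.1 0 1 ≠ 0 ∧ g.1 1 0 ≠ 0 := by
  have d := det_eq g
  constructor <;> intro k <;> rw [k] at d <;> simp [h] at d

/-- The big cell computation. -/
theorem big : cl (F := F) (fun g => g.1 1 0 = 0) * cl (fun g => g.1 0 0 = 0)
    = ((Fintype.card F : ℚ) - 1) • cl (fun g => g.1 1 0 ≠ 0) := by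
  have key : ∀ h : Matrix.SpecialLinearGroup (Fin 2) F,
      MonoidAlgebra.of ℚ _ h * cl (fun g => g.1 0 0 = 0)
        = cl (fun g => h.1 1 1 * g.1 0 0 = h.1 0 1 * g.1 1 0) := by
    intro h
    refine of_mul_cl _ _ h fun g => ?_
    rw [m00, m10]
    have d := det_eq h
    rw [← sub_eq_zero]
    have : h.1 1 1 * (h.1 0 0 * g.1 0 0 + h.1 0 1 * g.1 1 0) -
      h.1 0 1 * (h.1 1 0 * g.1 0 0 + h.1 1 1 * g.1 1 0) = g.1 0 0 := by
      linear_combination g.1 0 0 * d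
    rw [this]
  rw [cl, ← Finset.sum_filter, Finset.sum_mul, Finset.sum_congr rfl fun h _ => key h]
  unfold cl
  rw [Finset.sum_comm, Finset.smul_sum]
  refine Finset.sum_congr rfl fun g _ => ?_
  rw [← Finset.sum_filter, Finset.sum_const, Finset.filter_filter]
  by_cases hc : g.1 1 0 = 0
  · rw [if_neg (by simpa using hc), smul_zero, Finset.filter_false_of_mem, Finset.card_empty,
      zero_smul]
    rintro h - ⟨h1, h2⟩
    rw [hc, mul_zero] at h2
    exact mul_ne_zero (dA h (by rw [h1, mul_zero])).2 (dA g (by rw [hc, mul_zero])).1 h2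
  · rw [if_pos hc, ← Nat.cast_smul_eq_nsmul ℚ]
    congr 1
    have : Finset.univ.filter (fun h : Matrix.SpecialLinearGroup (Fin 2) F =>
          h.1 1 0 = 0 ∧ h.1 1 1 * g.1 0 0 = h.1 0 1 * g.1 1 0)
        = Finset.univ.image (fun a : Fˣ => bor (a, ((a⁻¹ : Fˣ) : F) * g.1 0 0 / g.1 1 0)) := by
      ext h
      simp only [Finset.mem_filter, Finset.mem_univ, true_and, Finset.mem_image]
      constructor
      · rintro ⟨h1, h2⟩
        have d := det_eq h
        rw [h1, mul_zero, sub_zero] at d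
        refine ⟨⟨h.1 0 0, h.1 1 1, d, by rw [mul_comm]; exact d⟩, ?_⟩
        have h3 : h.1 1 1 * g.1 0 0 / g.1 1 0 = h.1 0 1 := by rw [h2]; field_simp
        ext i j
        fin_cases i <;> fin_cases j <;> simp [bor, h1]
        exact h3
      · rintro ⟨a, rfl⟩
        simp [bor]
        field_simp
    rw [this, Finset.card_image_of_injective, Finset.card_univ, card_units]
    intro a c h
    have h0 := congrArg (fun g => g.1 0 0) h
    simp [bor] at h0
    simp [Units.ext_iff, h0]

theorem suppClass_eq (a b c d : Bool) : suppClass ℚ F a b c d = cl (fun g =>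
        (a = true ↔ g.1 0 0 ≠ 0) ∧ (b = true ↔ g.1 0 1 ≠ 0) ∧
        (c = true ↔ g.1 1 0 ≠ 0) ∧ (d = true ↔ g.1 1 1 ≠ 0)) := by
  rw [suppClass, cl, Finset.sum_filter]

end SuppAux

open SuppAux

theorem matrix_units (F : Type*) [Field F] [Fintype F] [DecidableEq F]
    (hq : 2 < Fintype.card F) (q : ℚ) (hqc : q = Fintype.card F)
    (M : Fin 2 → Fin 2 → MonoidAlgebra ℚ (Matrix.SpecialLinearGroup (Fin 2) F))
    (hM₁₁ : M 0 0 = (q ^ 2 - 1)⁻¹ • (elA ℚ F - elB ℚ F) +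
      (2 * (q ^ 2 - 1))⁻¹ • (elDp ℚ F + elDm ℚ F - elEp ℚ F - elEm ℚ F))
    (hM₁₂ : M 0 1 = (2 * (q - 1) ^ 2)⁻¹ • (elDp ℚ F - elDm ℚ F + elEp ℚ F - elEm ℚ F))
    (hM₂₁ : M 1 0 = (2 * (q ^ 2 - 1))⁻¹ • (elDp ℚ F - elDm ℚ F - elEp ℚ F + elEm ℚ F))
    (hM₂₂ : M 1 1 = (q ^ 2 - 1)⁻¹ • (elA ℚ F + elB ℚ F) -
      (2 / ((q + 1) * (q - 1) ^ 2)) • elC ℚ F +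
      ((q - 3) / (2 * (q + 1) * (q - 1) ^ 2)) • (elDp ℚ F + elDm ℚ F + elEp ℚ F + elEm ℚ F))
    (π₄ : MonoidAlgebra ℚ (Matrix.SpecialLinearGroup (Fin 2) F))
    (hπ₄ : π₄ = ((q + 1) * (q - 1) ^ 2)⁻¹ •
      ((2 * (q - 1)) • elA ℚ F - (2 : ℚ) • elC ℚ F + (q - 2) • (elDp ℚ F + elDm ℚ F) -
        (elEp ℚ F + elEm ℚ F))) :
    (∀ i j k l : Fin 2, M i j * M k l = if j = k then M i l else 0) ∧
    M 0 0 + M 1 1 = π₄ := by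
  have hp : q - 1 ≠ 0 := by
    have : (2 : ℚ) < q := by rw [hqc]; exact_mod_cast hq
    linarith
  have hp1 : q + 1 ≠ 0 := by
    have : (2 : ℚ) < q := by rw [hqc]; exact_mod_cast hq
    linarith
  let G := Matrix.SpecialLinearGroup (Fin 2) F
  have cA := card_A (F := F)
  have cB := card_B (F := F)
  have cX := card_X (F := F)
  have hbig := big (F := F)
  rw [← hqc] at cA cB cX hbig
  have AA := cl_mul_left (fun g : G => g.1 0 1 = 0 ∧ g.1 1 0 = 0)
    (fun g : G => g.1 0 1 = 0 ∧ g.1 1 0 = 0) (fun g : G => g.1 0 1 = 0 ∧ g.1 1 0 = 0) _ cA (by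
    rintro h ⟨h1, h2⟩ g
    obtain ⟨h3, h4⟩ := dA h (by simp [h1])
    simp [m01, m10, h1, h2, h3, h4])
  have AB := cl_mul_left (fun g : G => g.1 0 1 = 0 ∧ g.1 1 0 = 0)
    (fun g : G => g.1 0 0 = 0 ∧ g.1 1 1 = 0) (fun g : G => g.1 0 0 = 0 ∧ g.1 1 1 = 0) _ cA (by
    rintro h ⟨h1, h2⟩ g
    obtain ⟨h3, h4⟩ := dA h (by simp [h1])
    simp [m00, m11, h1, h2, h3, h4])
  have BA := cl_mul_left (fun g : G => g.1 0 0 = 0 ∧ g.1 1 1 = 0)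
    (fun g : G => g.1 0 1 = 0 ∧ g.1 1 0 = 0) (fun g : G => g.1 0 0 = 0 ∧ g.1 1 1 = 0) _ cB (by
    rintro h ⟨h1, h2⟩ g
    obtain ⟨h3, h4⟩ := dB h (by simp [h1])
    simp [m00, m11, h1, h2, h3, h4, and_comm])
  have BB := cl_mul_left (fun g : G => g.1 0 0 = 0 ∧ g.1 1 1 = 0)
    (fun g : G => g.1 0 0 = 0 ∧ g.1 1 1 = 0) (fun g : G => g.1 0 1 = 0 ∧ g.1 1 0 = 0) _ cB (by
    rintro h ⟨h1, h2⟩ g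
    obtain ⟨h3, h4⟩ := dB h (by simp [h1])
    simp [m01, m10, h1, h2, h3, h4, and_comm])
  have AX := cl_mul_left (fun g : G => g.1 0 1 = 0 ∧ g.1 1 0 = 0)
    (fun g : G => g.1 1 0 = 0) (fun g : G => g.1 1 0 = 0) _ cA (by
    rintro h ⟨h1, h2⟩ g
    obtain ⟨h3, h4⟩ := dA h (by simp [h1])
    simp [m10, h1, h2, h3, h4])
  have XA := cl_mul_right (fun g : G => g.1 1 0 = 0)
    (fun g : G => g.1 0 1 = 0 ∧ g.1 1 0 = 0) (fun g : G => g.1 1 0 = 0) _ cA (by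
    rintro h ⟨h1, h2⟩ g
    obtain ⟨h3, h4⟩ := dA h (by simp [h1])
    simp [m10, h1, h2, h3, h4])
  have BX := cl_mul_left (fun g : G => g.1 0 0 = 0 ∧ g.1 1 1 = 0)
    (fun g : G => g.1 1 0 = 0) (fun g : G => g.1 0 0 = 0) _ cB (by
    rintro h ⟨h1, h2⟩ g
    obtain ⟨h3, h4⟩ := dB h (by simp [h1])
    simp [m00, h1, h2, h3, h4])
  have XB := cl_mul_right (fun g : G => g.1 1 0 = 0)
    (fun g : G => g.1 0 0 = 0 ∧ g.1 1 1 = 0) (fun g : G => g.1 1 1 = 0) _ cB (by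
    rintro h ⟨h1, h2⟩ g
    obtain ⟨h3, h4⟩ := dB h (by simp [h1])
    simp [m11, h1, h2, h3, h4])
  have BXB := cl_mul_left (fun g : G => g.1 0 0 = 0 ∧ g.1 1 1 = 0)
    (fun g : G => g.1 1 1 = 0) (fun g : G => g.1 0 1 = 0) _ cB (by
    rintro h ⟨h1, h2⟩ g
    obtain ⟨h3, h4⟩ := dB h (by simp [h1])
    simp [m01, h1, h2, h3, h4])
  have XX := cl_mul_left (fun g : G => g.1 1 0 = 0)
    (fun g : G => g.1 1 0 = 0) (fun g : G => g.1 1 0 = 0) _ cX (by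
    rintro h h2 g
    obtain ⟨h3, h4⟩ := dA h (by simp [h2])
    simp [m10, h2, h3, h4])
  have AS := cl_mul_left (fun g : G => g.1 0 1 = 0 ∧ g.1 1 0 = 0)
    (fun _ : G => True) (fun _ : G => True) _ cA (by simp)
  have SA := cl_mul_right (fun _ : G => True) (fun g : G => g.1 0 1 = 0 ∧ g.1 1 0 = 0)
    (fun _ : G => True) _ cA (by simp)
  have BS := cl_mul_left (fun g : G => g.1 0 0 = 0 ∧ g.1 1 1 = 0)
    (fun _ : G => True) (fun _ : G => True) _ cB (by simp)
  have SB := cl_mul_right (fun _ : G => True) (fun g : G => g.1 0 0 = 0 ∧ g.1 1 1 = 0)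
    (fun _ : G => True) _ cB (by simp)
  have XS := cl_mul_left (fun g : G => g.1 1 0 = 0)
    (fun _ : G => True) (fun _ : G => True) _ cX (by simp)
  have SX := cl_mul_right (fun _ : G => True) (fun g : G => g.1 1 0 = 0)
    (fun _ : G => True) _ cX (by simp)
  have hcell := cl_add (fun g : G => g.1 1 0 = 0) (fun g : G => g.1 1 0 ≠ 0)
    (fun _ : G => True) (fun g => by simp [em]) (fun g => by simp)
  have lA : elA ℚ F = cl (fun g : G => g.1 0 1 = 0 ∧ g.1 1 0 = 0) := by
    rw [elA, suppClass_eq]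
    refine cl_congr _ _ fun g => ?_
    have := dA g
    simp; grind
  have lB : elB ℚ F = cl (fun g : G => g.1 0 0 = 0 ∧ g.1 1 1 = 0) := by
    rw [elB, suppClass_eq]
    refine cl_congr _ _ fun g => ?_
    have := dB g
    simp; grind
  have lX : cl (fun g : G => g.1 1 0 = 0) = elDp ℚ F + elA ℚ F := by
    rw [lA, elDp, suppClass_eq]
    refine cl_add _ _ _ (fun g => ?_) (fun g => ?_) <;> have := dA g <;> simp <;> grind
  have lY : cl (fun g : G => g.1 0 1 = 0) = elDm ℚ F + elA ℚ F := by
    rw [lA, elDm, suppClass_eq]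
    refine cl_add _ _ _ (fun g => ?_) (fun g => ?_) <;> have := dA g <;> simp <;> grind
  have lXB : cl (fun g : G => g.1 1 1 = 0) = elEp ℚ F + elB ℚ F := by
    rw [lB, elEp, suppClass_eq]
    refine cl_add _ _ _ (fun g => ?_) (fun g => ?_) <;> have := dB g <;> simp <;> grind
  have lBX : cl (fun g : G => g.1 0 0 = 0) = elEm ℚ F + elB ℚ F := by
    rw [lB, elEm, suppClass_eq]
    refine cl_add _ _ _ (fun g => ?_) (fun g => ?_) <;> have := dB g <;> simp <;> grind
  have lS : cl (fun _ : G => True) = elC ℚ F + (elDm ℚ F + (elEp ℚ F + elB ℚ F)) +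
      (elDp ℚ F + elA ℚ F) + elEm ℚ F := by
    rw [← lXB, ← lX, elC, elDm, elEm, suppClass_eq, suppClass_eq, suppClass_eq]
    rw [← cl_add _ _ (fun g : G => g.1 1 1 = 0 ∨ (g.1 0 0 ≠ 0 ∧ g.1 0 1 = 0 ∧ g.1 1 0 ≠ 0)),
      ← cl_add _ _ (fun g : G => g.1 1 0 ≠ 0 ∧ (g.1 0 0 ≠ 0 ∨ g.1 1 1 = 0)),
      ← cl_add _ _ (fun g : G => g.1 1 0 = 0 ∨ (g.1 0 0 ≠ 0 ∨ g.1 1 1 = 0)),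
      ← cl_add _ _ (fun _ : G => True)]
    all_goals intro g
    all_goals have := dA g
    all_goals have := dB g
    all_goals simp
    all_goals grind
  generalize cl (fun g : G => g.1 0 1 = 0 ∧ g.1 1 0 = 0) = A at *
  generalize cl (fun g : G => g.1 0 0 = 0 ∧ g.1 1 1 = 0) = B at *
  generalize cl (fun g : G => g.1 1 0 = 0) = X at *
  generalize cl (fun g : G => g.1 0 1 = 0) = Y at *
  generalize cl (fun g : G => g.1 1 1 = 0) = Z at *
  generalize cl (fun g : G => g.1 0 0 = 0) = W at *
  generalize cl (fun _ : G => True) = S at *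
  generalize cl (fun g : G => g.1 1 0 ≠ 0) = V at *
  have sc : ∀ P Q R : MonoidAlgebra ℚ (Matrix.SpecialLinearGroup (Fin 2) F),
      P * Q = (q - 1) • R →
      ((q - 1)⁻¹ • P) * ((q - 1)⁻¹ • Q) = (q - 1)⁻¹ • R := by
    intro P Q R h
    rw [smul_mul_smul_comm, h, smul_smul]
    congr 1
    field_simp
  have sc2 : ∀ P Q R : MonoidAlgebra ℚ (Matrix.SpecialLinearGroup (Fin 2) F),
      P * Q = (q * (q - 1)) • R →
      ((q - 1)⁻¹ • P) * ((q - 1)⁻¹ • Q) = q • (q - 1)⁻¹ • R := by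
    intro P Q R h
    rw [smul_mul_smul_comm, h, smul_smul, smul_smul]
    congr 1
    field_simp
  refine ⟨alg q hp1 hp ((q - 1)⁻¹ • A) ((q - 1)⁻¹ • B) ((q - 1)⁻¹ • X) ((q - 1)⁻¹ • S)
    (sc _ _ _ AA) (sc _ _ _ AB) (sc _ _ _ BA) (sc _ _ _ BB) (sc _ _ _ AX) (sc _ _ _ XA)
    (sc2 _ _ _ XX) ?_ (sc _ _ _ AS) (sc _ _ _ SA) (sc _ _ _ BS) (sc _ _ _ SB)
    (sc2 _ _ _ XS) (sc2 _ _ _ SX) _ _ _ _ _ _ _ ?_ ?_ ?_ ?_ ?_ ?_ ?_ M hM₁₁ hM₁₂ hM₂₁ hM₂₂, ?_⟩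
  · rw [sc _ _ _ BX, sc _ _ _ hbig, hcell]
    module
  · rw [smul_inv_smul₀ hp, lA]
  · rw [smul_inv_smul₀ hp, lB]
  · rw [smul_inv_smul₀ hp, lX]; abel
  · rw [sc _ _ _ XB, sc _ _ _ BXB, smul_inv_smul₀ hp, lY]; abel
  · rw [sc _ _ _ XB, smul_inv_smul₀ hp, lXB]; abel
  · rw [sc _ _ _ BX, smul_inv_smul₀ hp, lBX]; abel
  · rw [smul_inv_smul₀ hp, lS]; abel
  · have h3 : q ^ 2 - 1 ≠ 0 := by
      have : q ^ 2 - 1 = (q + 1) * (q - 1) := by ring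
      rw [this]; exact mul_ne_zero hp1 hp
    rw [hM₁₁, hM₂₂, hπ₄]
    match_scalars <;> field_simp <;> ring
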